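/- arXiv:1305.1572 — 2 statements merged into one kernel-verified Lean document; each statement's English description precedes it below -/
import Mathlib

section
/- Let λ, M > 0, S₀ ∈ ℝ and c ∈ ℝ. Let g, h : ℝ × (0,1) → ℝ be C¹ functions satisfying the Cauchy–Riemann relations ∂g/∂s = ∂h/∂t and ∂g/∂t = −∂h/∂s on ℝ × (0,1). If |∂h/∂s (s,t)| ≤ M e^{−λs} and |∂h/∂t (s,t) − c| ≤ M e^{−λs} for all s ≥ S₀ and all t ∈ (0,1), then there exist B ∈ ℝ and M′ > 0 such that |g(s,t) − B − c s| ≤ M′ e^{−λs} for all s ≥ S₀ and all t ∈ (0,1). -/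
open Real Set

/-- A function on `[S, ∞)` whose derivative is `O(e^{−λx})` converges at that rate. -/
theorem exists_abs_sub_le_exp_of_abs_deriv_le {f f' : ℝ → ℝ} {lam M S : ℝ} (hlam : 0 < lam)
    (hf : ∀ x, S ≤ x → HasDerivAt f (f' x) x)
    (hf' : ∀ x, S ≤ x → |f' x| ≤ M * Real.exp (-lam * x)) :
    ∃ B : ℝ, ∀ x, S ≤ x → |f x - B| ≤ M / lam * Real.exp (-lam * x) := by
  set E : ℝ → ℝ := fun x => M / lam * Real.exp (-lam * x) with hE
  have hE' : ∀ x, HasDerivAt E (-(M * Real.exp (-lam * x))) x := by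
    intro x
    have h := (((hasDerivAt_id x).const_mul (-lam)).exp).const_mul (M / lam)
    refine h.congr_deriv ?_
    simp only [id]
    field_simp
  have hmono : MonotoneOn (fun x => f x - E x) (Ici S) := by
    refine monotoneOn_of_hasDerivWithinAt_nonneg (convex_Ici S)
      (fun x hx => ((hf x hx).sub (hE' x)).continuousAt.continuousWithinAt)
      (fun x hx => ((hf x (interior_subset hx)).sub (hE' x)).hasDerivWithinAt) fun x hx => ?_
    linarith [(abs_le.mp (hf' x (interior_subset hx))).1]
  have hanti : AntitoneOn (fun x => f x + E x) (Ici S) := by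
    refine antitoneOn_of_hasDerivWithinAt_nonpos (convex_Ici S)
      (fun x hx => ((hf x hx).add (hE' x)).continuousAt.continuousWithinAt)
      (fun x hx => ((hf x (interior_subset hx)).add (hE' x)).hasDerivWithinAt) fun x hx => ?_
    linarith [(abs_le.mp (hf' x (interior_subset hx))).2]
  have hEnonneg : ∀ x, S ≤ x → 0 ≤ E x := fun x hx => by
    have h : 0 ≤ M * Real.exp (-lam * x) := (abs_nonneg _).trans (hf' x hx)
    have : E x = M * Real.exp (-lam * x) / lam := by simp only [hE]; ring
    rw [this]
    positivity
  have hle : ∀ x, S ≤ x → ∀ y, S ≤ y → f x - E x ≤ f y + E y := by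
    intro x hx y hy
    have hm : S ≤ max x y := hx.trans (le_max_left x y)
    have h1 := hmono hx hm (le_max_left x y)
    have h2 := hanti hy hm (le_max_right x y)
    have h3 := hEnonneg _ hm
    simp only at h1 h2
    linarith
  refine ⟨sSup ((fun x => f x - E x) '' Ici S), fun x hx => ?_⟩
  have h1 : f x - E x ≤ sSup ((fun x => f x - E x) '' Ici S) := by
    refine le_csSup ⟨f S + E S, ?_⟩ ⟨x, hx, rfl⟩
    rintro _ ⟨y, hy, rfl⟩
    exact hle y hy S le_rfl
  have h2 : sSup ((fun x => f x - E x) '' Ici S) ≤ f x + E x := by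
    refine csSup_le ⟨_, S, self_mem_Ici, rfl⟩ ?_
    rintro _ ⟨y, hy, rfl⟩
    exact hle y hy x hx
  change |_| ≤ E x
  rw [abs_le]
  constructor <;> linarith

/-- Integrating the Cauchy–Riemann equations on the strip: if `(g,h)` is a `C¹` pair on
`ℝ × (0,1)` satisfying `∂g/∂s = ∂h/∂t` and `∂g/∂t = −∂h/∂s`, and the partial derivatives of
`h` satisfy `|∂h/∂s| ≤ M e^{−λs}` and `|∂h/∂t − c| ≤ M e^{−λs}` for `s ≥ S₀`, then
`g(s,t) = B + c s + O(e^{−λs})` for some constant `B`. -/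
theorem harmonic_conjugate_asymptotics
    (lam M S₀ c : ℝ) (hlam : 0 < lam) (hM : 0 < M)
    (g h : ℝ → ℝ → ℝ)
    (hg : ContDiffOn ℝ 1 (fun p : ℝ × ℝ => g p.1 p.2) (Set.univ ×ˢ Set.Ioo (0 : ℝ) 1))
    (hh : ContDiffOn ℝ 1 (fun p : ℝ × ℝ => h p.1 p.2) (Set.univ ×ˢ Set.Ioo (0 : ℝ) 1))
    (hCR1 : ∀ s t : ℝ, 0 < t → t < 1 →
      deriv (fun x : ℝ => g x t) s = deriv (fun y : ℝ => h s y) t)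
    (hCR2 : ∀ s t : ℝ, 0 < t → t < 1 →
      deriv (fun y : ℝ => g s y) t = -deriv (fun x : ℝ => h x t) s)
    (hhs : ∀ s t : ℝ, S₀ ≤ s → 0 < t → t < 1 →
      |deriv (fun x : ℝ => h x t) s| ≤ M * Real.exp (-lam * s))
    (hht : ∀ s t : ℝ, S₀ ≤ s → 0 < t → t < 1 →
      |deriv (fun y : ℝ => h s y) t - c| ≤ M * Real.exp (-lam * s)) :
    ∃ (B M' : ℝ), 0 < M' ∧ ∀ s t : ℝ, S₀ ≤ s → 0 < t → t < 1 →
      |g s t - B - c * s| ≤ M' * Real.exp (-lam * s) := by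
  have hgd : ∀ s t : ℝ, 0 < t → t < 1 →
      DifferentiableAt ℝ (fun p : ℝ × ℝ => g p.1 p.2) (s, t) := fun s t h0 h1 =>
    (hg.contDiffAt ((isOpen_univ.prod isOpen_Ioo).mem_nhds
      ⟨mem_univ _, h0, h1⟩)).differentiableAt one_ne_zero
  have hgs : ∀ s t : ℝ, 0 < t → t < 1 → DifferentiableAt ℝ (fun x => g x t) s :=
    fun s t h0 h1 => DifferentiableAt.comp (f := fun x : ℝ => (x, t)) s (hgd s t h0 h1)
      (by fun_prop)
  have hgt : ∀ s t : ℝ, 0 < t → t < 1 → DifferentiableAt ℝ (fun y => g s y) t :=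
    fun s t h0 h1 => DifferentiableAt.comp (f := fun y : ℝ => (s, y)) t (hgd s t h0 h1)
      (by fun_prop)
  have h0 : (0 : ℝ) < 1 / 2 := by norm_num
  have h1 : (1 / 2 : ℝ) < 1 := by norm_num
  obtain ⟨B, hB⟩ := exists_abs_sub_le_exp_of_abs_deriv_le
    (f := fun s => g s (1 / 2) - c * s) (f' := fun s => deriv (fun x => g x (1 / 2)) s - c)
    (S := S₀) (M := M) hlam
    (fun s _ => by
      simpa only [mul_one] using! (hgs s _ h0 h1).hasDerivAt.sub ((hasDerivAt_id s).const_mul c))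
    (fun s hs => by
      simpa only [hCR1 s _ h0 h1] using hht s _ hs h0 h1)
  refine ⟨B, M / lam + M, by positivity, fun s t hs ht0 ht1 => ?_⟩
  have hvert : |g s t - g s (1 / 2)| ≤ M * Real.exp (-lam * s) * |t - 1 / 2| := by
    refine (convex_Ioo (0 : ℝ) 1).norm_image_sub_le_of_norm_deriv_le (f := fun y => g s y)
      (fun y hy => hgt s y hy.1 hy.2) (fun y hy => ?_) ⟨h0, h1⟩ ⟨ht0, ht1⟩
    rw [hCR2 s y hy.1 hy.2, norm_neg]
    exact hhs s y hs hy.1 hy.2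
  have hdist : |t - 1 / 2| ≤ 1 := by
    rw [abs_le]
    constructor <;> linarith
  have hvert' := hvert.trans (mul_le_of_le_one_right (by positivity) hdist)
  calc |g s t - B - c * s|
      = |(g s t - g s (1 / 2)) + (g s (1 / 2) - c * s - B)| := by congr 1; ring
    _ ≤ |g s t - g s (1 / 2)| + |g s (1 / 2) - c * s - B| := abs_add_le _ _
    _ ≤ (M / lam + M) * Real.exp (-lam * s) := by linarith [hB s hs]
end

section
/- Let λ ∈ (0,1), C₋, C₊ ∈ ℝ, S₀ ∈ ℝ and M > 0. Let a : S̄ → ℂ be continuous on the closed strip S̄, holomorphic on the open strip S, and such that Im a is bounded on S̄. Suppose the boundary values h₋(s) := Im a(s + i·0) and h₊(s) := Im a(s + i·1) are C¹ with bounded derivatives and satisfy |h₋(s) − C₋| ≤ M e^{−λs}, |h₊(s) − C₊| ≤ M e^{−λs}, |h₋′(s)| ≤ M e^{−λs} and |h₊′(s)| ≤ M e^{−λs} for all s ≥ S₀. Then there exist C ∈ ℂ, λ′ > 0 and M′ > 0 such that |a(s + it) − C − (C₊ − C₋)(s + it)| ≤ M′ e^{−λ′ s} for all s ≥ S₀ +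 1 and all t ∈ [0,1]. -/
open Real Complex

/-- The open unit strip `{s + it : s ∈ ℝ, 0 < t < 1}` in `ℂ`. -/
def openStrip : Set ℂ := {z : ℂ | 0 < z.im ∧ z.im < 1}

/-- The closed unit strip `{s + it : s ∈ ℝ, 0 ≤ t ≤ 1}` in `ℂ`. -/
def closedStrip : Set ℂ := {z : ℂ | 0 ≤ z.im ∧ z.im ≤ 1}

lemma isOpen_openStrip : IsOpen openStrip :=
  (isOpen_lt continuous_const Complex.continuous_im).inter
    (isOpen_lt Complex.continuous_im continuous_const)

lemma openStrip_subset_closedStrip : openStrip ⊆ closedStrip :=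
  fun _ hz => ⟨hz.1.le, hz.2.le⟩

lemma closure_openStrip_subset : closure openStrip ⊆ closedStrip :=
  closure_minimal openStrip_subset_closedStrip <|
    (isClosed_le continuous_const Complex.continuous_im).inter
      (isClosed_le Complex.continuous_im continuous_const)

/-- The maximum principle on the strip for the real part of a holomorphic function whose real
part is bounded above. -/
lemma re_nonpos_of_strip {φ : ℂ → ℂ} {K : ℝ} (hc : ContinuousOn φ closedStrip)
    (hd : DifferentiableOn ℂ φ openStrip) (hK : ∀ z ∈ closedStrip, (φ z).re ≤ K)
    (h0 : ∀ z : ℂ, z.im = 0 → (φ z).re ≤ 0) (h1 : ∀ z : ℂ, z.im = 1 → (φ z).re ≤ 0)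
    {z : ℂ} (hz : z ∈ closedStrip) : (φ z).re ≤ 0 := by
  have hset : Complex.im ⁻¹' Set.Ioo 0 1 = openStrip := rfl
  have key : ‖Complex.exp (φ z)‖ ≤ 1 := by
    refine PhragmenLindelof.horizontal_strip (f := fun z => Complex.exp (φ z)) (a := 0) (b := 1)
      ?_ ⟨0, by simp [Real.pi_pos], |K|, ?_⟩ ?_ ?_ hz.1 hz.2
    · rw [hset]
      exact ⟨hd.cexp, (hc.mono closure_openStrip_subset).cexp⟩
    · rw [hset]
      refine Asymptotics.IsBigO.of_bound 1 ?_
      refine Filter.Eventually.filter_mono inf_le_right ?_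
      rw [Filter.eventually_principal]
      intro w hw
      rw [Complex.norm_exp, Real.norm_of_nonneg (Real.exp_pos _).le, one_mul, Real.exp_le_exp]
      simpa using (hK w (openStrip_subset_closedStrip hw)).trans (le_abs_self K)
    · intro w hw
      simpa [Complex.norm_exp] using h0 w hw
    · intro w hw
      simpa [Complex.norm_exp] using h1 w hw
  simpa [Complex.norm_exp] using key

lemma half_le_cos {x : ℝ} (hx : |x| ≤ Real.pi / 3) : 1 / 2 ≤ Real.cos x := by
  rw [← Real.cos_pi_div_three, ← Real.cos_abs x]
  exact Real.cos_le_cos_of_nonneg_of_le_pi (abs_nonneg x) (by linarith [Real.pi_pos]) hx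

/-- The square root of a complex number in the closed right half plane has real part comparable
to its norm. -/
lemma re_cpow_half_bounds {x : ℂ} (hx : 0 ≤ x.re) :
    √‖x‖ ≤ 2 * (x ^ ((1 / 2 : ℝ) : ℂ)).re ∧ (x ^ ((1 / 2 : ℝ) : ℂ)).re ≤ √‖x‖ := by
  have harg := Complex.abs_arg_le_pi_div_two_iff.2 hx
  rw [Complex.cpow_ofReal_re, ← Real.sqrt_eq_rpow]
  have hcos : 1 / 2 ≤ Real.cos (x.arg * (1 / 2)) := by
    apply half_le_cos
    rw [abs_mul, abs_of_pos (by norm_num : (0 : ℝ) < 1 / 2)]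
    linarith [Real.pi_pos]
  have h0 := Real.sqrt_nonneg ‖x‖
  constructor
  · nlinarith
  · exact mul_le_of_le_one_right h0 (Real.cos_le_one _)

lemma im_sub_le_sqrt_of_boundary {f : ℂ → ℂ} {K L : ℝ} (hc : ContinuousOn f closedStrip)
    (hd : DifferentiableOn ℂ f openStrip) (hK : ∀ z ∈ closedStrip, |(f z).im| ≤ K) (hL0 : 0 ≤ L)
    (hL : ∀ x y : ℝ, |(f x).im - (f y).im| ≤ L * |x - y|) (s₀ : ℝ) {z : ℂ}
    (hz : z ∈ closedStrip) :
    (f z).im - (f s₀).im ≤ 2 * (L + 2 * K) * √‖z - s₀‖ := by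
  have hs₀ : (s₀ : ℂ) ∈ closedStrip := by simp [closedStrip]
  have hK0 : 0 ≤ K := (abs_nonneg _).trans (hK _ hs₀)
  have hre : ∀ w ∈ closedStrip, 0 ≤ (-Complex.I * (w - s₀)).re := by
    intro w hw
    simpa using hw.1
  have hnorm : ∀ w : ℂ, ‖-Complex.I * (w - s₀)‖ = ‖w - s₀‖ := by simp
  have hdiff : ∀ w ∈ closedStrip, (f w).im - (f s₀).im ≤ 2 * K := by
    intro w hw
    have h1 := abs_le.1 (hK w hw)
    have h2 := abs_le.1 (hK _ hs₀)
    linarith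
  have hfar : ∀ w ∈ closedStrip, 1 ≤ ‖w - s₀‖ →
      (f w).im - (f s₀).im ≤ (L + 2 * K) * √‖w - s₀‖ := by
    intro w hw h1
    have h2 := hdiff w hw
    have h3 : 1 ≤ √‖w - s₀‖ := Real.one_le_sqrt.2 h1
    nlinarith
  have hbd : ∀ w ∈ closedStrip, (f w).im - (f s₀).im ≤ (L + 2 * K) * √‖w - s₀‖ →
      (-Complex.I * f w - (f s₀).im - ((2 * (L + 2 * K) : ℝ) : ℂ) *
        (-Complex.I * (w - s₀)) ^ ((1 / 2 : ℝ) : ℂ)).re ≤ 0 := by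
    intro w hw h
    have h4 := (re_cpow_half_bounds (hre w hw)).1
    rw [hnorm] at h4
    have h5 : (-Complex.I * f w - (f s₀).im - ((2 * (L + 2 * K) : ℝ) : ℂ) *
        (-Complex.I * (w - s₀)) ^ ((1 / 2 : ℝ) : ℂ)).re = (f w).im - (f s₀).im
        - 2 * (L + 2 * K) * ((-Complex.I * (w - s₀)) ^ ((1 / 2 : ℝ) : ℂ)).re := by
      rw [Complex.sub_re, Complex.re_ofReal_mul]
      simp
    rw [h5]
    nlinarith
  have key := re_nonpos_of_strip (K := 2 * K)
    (φ := fun w => -Complex.I * f w - (f s₀).im - ((2 * (L + 2 * K) : ℝ) : ℂ) *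
        (-Complex.I * (w - s₀)) ^ ((1 / 2 : ℝ) : ℂ)) ?_ ?_ ?_ ?_ ?_ hz
  · rw [Complex.sub_re, Complex.re_ofReal_mul] at key
    have h6 := (re_cpow_half_bounds (hre z hz)).2
    rw [hnorm] at h6
    simp only [Complex.sub_re, Complex.ofReal_re, neg_mul, Complex.neg_re, Complex.mul_re,
      Complex.I_re, Complex.I_im, zero_mul, one_mul, zero_sub, neg_neg] at key h6
    nlinarith
  · refine ((continuousOn_const.mul hc).sub continuousOn_const).sub (continuousOn_const.mul ?_)
    intro w hw
    refine ContinuousAt.continuousWithinAt ?_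
    exact ContinuousAt.comp (f := fun w : ℂ => -Complex.I * (w - s₀))
      (Complex.continuousAt_cpow_const_of_re_pos (Or.inl (hre w hw)) (by simp))
      (by fun_prop)
  · refine ((hd.const_mul _).sub_const _).sub (DifferentiableOn.const_mul ?_ _)
    intro w hw
    refine DifferentiableAt.differentiableWithinAt ?_
    refine DifferentiableAt.cpow (by fun_prop) (by fun_prop) (Or.inl ?_)
    simpa using hw.1
  · intro w hw
    have h7 := hdiff w hw
    have h8 := (re_cpow_half_bounds (hre w hw)).1
    have h9 := Real.sqrt_nonneg ‖-Complex.I * (w - s₀)‖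
    rw [Complex.sub_re, Complex.re_ofReal_mul]
    have h10 : 0 ≤ 2 * (L + 2 * K) * ((-Complex.I * (w - s₀)) ^ ((1 / 2 : ℝ) : ℂ)).re :=
      mul_nonneg (by positivity) (by linarith)
    have h11 : (-Complex.I * f w - (f s₀).im).re = (f w).im - (f s₀).im := by simp
    rw [h11]
    linarith
  · intro w hw
    have hw' : w ∈ closedStrip := by simp [closedStrip, hw]
    refine hbd w hw' ?_
    · rcases le_total 1 ‖w - s₀‖ with h | h
      · exact hfar w hw' h
      · obtain ⟨x, rfl⟩ : ∃ x : ℝ, w = x := ⟨w.re, by apply Complex.ext <;> simp [hw]⟩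
        rw [← Complex.ofReal_sub, Complex.norm_real, Real.norm_eq_abs] at h ⊢
        have h12 := (le_abs_self _).trans (hL x s₀)
        have h13 : |x - s₀| ≤ √|x - s₀| := Real.le_sqrt_of_sq_le (by nlinarith [abs_nonneg (x - s₀)])
        nlinarith [Real.sqrt_nonneg |x - s₀|]
  · intro w hw
    have hw' : w ∈ closedStrip := by simp [closedStrip, hw]
    refine hbd w hw' (hfar w hw' ?_)
    · have := Complex.abs_im_le_norm (w - s₀)
      simpa [hw] using this

/-- A holomorphic function on the strip with bounded imaginary part that is Lipschitz on the real
axis has imaginary part that is Hölder continuous of exponent `1 / 2` at the real axis. -/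
lemma abs_im_sub_le_sqrt {f : ℂ → ℂ} {K L : ℝ} (hc : ContinuousOn f closedStrip)
    (hd : DifferentiableOn ℂ f openStrip) (hK : ∀ z ∈ closedStrip, |(f z).im| ≤ K) (hL0 : 0 ≤ L)
    (hL : ∀ x y : ℝ, |(f x).im - (f y).im| ≤ L * |x - y|) (s₀ : ℝ) {z : ℂ}
    (hz : z ∈ closedStrip) :
    |(f z).im - (f s₀).im| ≤ 2 * (L + 2 * K) * √‖z - s₀‖ := by
  have h1 := im_sub_le_sqrt_of_boundary hc hd hK hL0 hL s₀ hz
  have h2 := im_sub_le_sqrt_of_boundary (f := fun z => -f z) hc.neg hd.neg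
    (by simpa using hK) hL0 (fun x y => by
      have := hL y x
      rw [abs_sub_comm y x] at this
      simpa [sub_eq_add_neg, add_comm] using this) s₀ hz
  simp only [Complex.neg_im] at h2
  exact abs_le.2 ⟨by linarith, h1⟩

lemma im_le_exp_of_boundary {f : ℂ → ℂ} {K A lam : ℝ} (hlam0 : 0 < lam) (hlam1 : lam < 1)
    (hA : 0 ≤ A) (hc : ContinuousOn f closedStrip)
    (hd : DifferentiableOn ℂ f openStrip) (hK : ∀ z ∈ closedStrip, |(f z).im| ≤ K)
    (h0 : ∀ z : ℂ, z.im = 0 → |(f z).im| ≤ A * Real.exp (-lam * z.re))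
    (h1 : ∀ z : ℂ, z.im = 1 → |(f z).im| ≤ A * Real.exp (-lam * z.re)) {z : ℂ}
    (hz : z ∈ closedStrip) : (f z).im ≤ 2 * A * Real.exp (-lam * z.re) := by
  have hcos : ∀ w ∈ closedStrip, 1 / 2 ≤ Real.cos (lam * (w.im - 1 / 2)) := by
    intro w hw
    apply half_le_cos
    rw [abs_mul, abs_of_pos hlam0]
    have : |w.im - 1 / 2| ≤ 1 / 2 := abs_le.2 ⟨by linarith [hw.1], by linarith [hw.2]⟩
    nlinarith [abs_nonneg (w.im - 1 / 2), Real.pi_gt_three]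
  have hre : ∀ w : ℂ, (-Complex.I * f w - ((2 * A : ℝ) : ℂ) *
      Complex.exp (-lam * (w - Complex.I / 2))).re = (f w).im - 2 * A *
      (Real.exp (-lam * w.re) * Real.cos (lam * (w.im - 1 / 2))) := by
    intro w
    rw [Complex.sub_re, Complex.re_ofReal_mul, Complex.exp_re]
    have e1 : (-(lam : ℂ) * (w - Complex.I / 2)).re = -lam * w.re := by simp
    have e2 : (-(lam : ℂ) * (w - Complex.I / 2)).im = -(lam * (w.im - 1 / 2)) := by simp
    rw [e1, e2, Real.cos_neg]
    simp
  have hbd : ∀ w ∈ closedStrip, |(f w).im| ≤ A * Real.exp (-lam * w.re) →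
      (f w).im - 2 * A * (Real.exp (-lam * w.re) * Real.cos (lam * (w.im - 1 / 2))) ≤ 0 := by
    intro w hw h
    have h2 := (le_abs_self _).trans h
    have h3 := mul_le_mul_of_nonneg_left (hcos w hw)
      (mul_nonneg hA (Real.exp_pos (-lam * w.re)).le)
    linarith
  have key := re_nonpos_of_strip (K := K)
    (φ := fun w => -Complex.I * f w - ((2 * A : ℝ) : ℂ) *
      Complex.exp (-lam * (w - Complex.I / 2))) ?_ ?_ ?_ ?_ ?_ hz
  · rw [hre] at key
    have h4 := mul_le_of_le_one_right (mul_nonneg hA (Real.exp_pos (-lam * z.re)).le)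
      (Real.cos_le_one (lam * (z.im - 1 / 2)))
    linarith
  · exact (continuousOn_const.mul hc).sub (Continuous.continuousOn (by fun_prop))
  · exact (hd.const_mul _).sub (Differentiable.differentiableOn (by fun_prop))
  · intro w hw
    rw [hre]
    have h5 := (le_abs_self _).trans (hK w hw)
    have h6 := hcos w hw
    have h7 : 0 ≤ 2 * A * (Real.exp (-lam * w.re) * Real.cos (lam * (w.im - 1 / 2))) := by
      have : 0 ≤ Real.cos (lam * (w.im - 1 / 2)) := by linarith
      positivity
    linarith
  · intro w hw
    rw [hre]
    exact hbd w (by simp [closedStrip, hw]) (h0 w hw)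
  · intro w hw
    rw [hre]
    exact hbd w (by simp [closedStrip, hw]) (h1 w hw)

/-- Exponential decay of the imaginary part on the boundary of the strip propagates to the
interior. -/
lemma abs_im_le_exp {f : ℂ → ℂ} {K A lam : ℝ} (hlam0 : 0 < lam) (hlam1 : lam < 1)
    (hA : 0 ≤ A) (hc : ContinuousOn f closedStrip)
    (hd : DifferentiableOn ℂ f openStrip) (hK : ∀ z ∈ closedStrip, |(f z).im| ≤ K)
    (h0 : ∀ z : ℂ, z.im = 0 → |(f z).im| ≤ A * Real.exp (-lam * z.re))
    (h1 : ∀ z : ℂ, z.im = 1 → |(f z).im| ≤ A * Real.exp (-lam * z.re)) {z : ℂ}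
    (hz : z ∈ closedStrip) : |(f z).im| ≤ 2 * A * Real.exp (-lam * z.re) := by
  have h2 := im_le_exp_of_boundary hlam0 hlam1 hA hc hd hK h0 h1 hz
  have h3 := im_le_exp_of_boundary (f := fun z => -f z) hlam0 hlam1 hA hc.neg hd.neg
    (by simpa using hK) (by simpa using h0) (by simpa using h1) hz
  simp only [Complex.neg_im] at h3
  exact abs_le.2 ⟨by linarith, h2⟩

/-- A derivative estimate for holomorphic functions in terms of the oscillation of the imaginary
part. -/
lemma norm_deriv_le_of_abs_im_sub_le {f : ℂ → ℂ} {c : ℂ} {R N h : ℝ} (hR : 0 < R) (hN : 0 < N)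
    (hf : DifferentiableOn ℂ f (Metric.ball c R))
    (him : ∀ z ∈ Metric.ball c R, |(f z).im - h| ≤ N) : ‖deriv f c‖ ≤ 8 * N / R := by
  have hmem : ∀ w ∈ Metric.ball (0 : ℂ) R, c + w ∈ Metric.ball c R := by
    intro w hw
    simpa using hw
  have hg : DifferentiableOn ℂ (fun w => -Complex.I * (f (c + w) - f c)) (Metric.ball 0 R) :=
    ((hf.comp (by fun_prop : DifferentiableOn ℂ (fun w => c + w) (Metric.ball 0 R))
      hmem).sub_const _).const_mul _
  have hbc : ∀ w ∈ Metric.ball (0 : ℂ) (R / 2), ‖f (c + w) - f c‖ ≤ 4 * N := by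
    intro w hw
    have hw1 : ‖w‖ < R / 2 := by simpa using hw
    have h1 := Complex.borelCaratheodory_zero (M := 2 * N) (by positivity) hg ?_ hR
      (Metric.ball_subset_ball (by linarith) hw) (by simp)
    · simp only [norm_mul, norm_neg, Complex.norm_I, one_mul] at h1
      refine h1.trans ?_
      rw [div_le_iff₀ (by linarith)]
      nlinarith
    · intro v hv
      have h2 := abs_le.1 (him _ (hmem v hv))
      have h3 := abs_le.1 (him c (Metric.mem_ball_self hR))
      simp only [Set.mem_ofPred_eq, neg_mul, Complex.neg_re, Complex.I_mul_re, neg_neg,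
        Complex.sub_im]
      linarith
  have h4 := Complex.norm_deriv_le_div_of_mapsTo_ball (R₁ := R / 2) (R₂ := 4 * N)
    (hf.mono (Metric.ball_subset_ball (by linarith))) (fun z hz => ?_) (by positivity)
  · refine h4.trans (le_of_eq ?_)
    field_simp
    norm_num
  · rw [mem_closedBall_iff_norm]
    simpa using hbc (z - c) (by simpa [dist_eq_norm] using hz)

lemma hasDerivAt_vertical {f : ℂ → ℂ} (hd : DifferentiableOn ℂ f openStrip) {s t : ℝ}
    (ht0 : 0 < t) (ht1 : t < 1) :
    HasDerivAt (fun τ : ℝ => f (s + τ * Complex.I))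
      (deriv f (s + t * Complex.I) * Complex.I) t := by
  have h1 : HasDerivAt f (deriv f (s + t * Complex.I)) (s + t * Complex.I) :=
    (hd.differentiableAt (isOpen_openStrip.mem_nhds (by simp [openStrip, ht0, ht1]))).hasDerivAt
  have h2 : HasDerivAt (fun z : ℂ => s + z * Complex.I) Complex.I (t : ℂ) := by
    simpa using ((hasDerivAt_id (t : ℂ)).mul_const Complex.I).const_add (s : ℂ)
  exact (h1.comp (t : ℂ) h2).comp_ofReal

lemma hasDerivAt_horizontal {f : ℂ → ℂ} (hd : DifferentiableOn ℂ f openStrip) (s : ℝ) :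
    HasDerivAt (fun σ : ℝ => f (σ + Complex.I / 2)) (deriv f (s + Complex.I / 2)) s := by
  have h1 : HasDerivAt f (deriv f (s + Complex.I / 2)) (s + Complex.I / 2) :=
    (hd.differentiableAt (isOpen_openStrip.mem_nhds (by norm_num [openStrip]))).hasDerivAt
  have h2 : HasDerivAt (fun z : ℂ => z + Complex.I / 2) 1 (s : ℂ) :=
    (hasDerivAt_id (s : ℂ)).add_const _
  simpa using (h1.comp (s : ℂ) h2).comp_ofReal

lemma continuousOn_vertical {f : ℂ → ℂ} (hc : ContinuousOn f closedStrip) (s : ℝ) :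
    ContinuousOn (fun τ : ℝ => f (s + τ * Complex.I)) (Set.Icc 0 1) := by
  refine hc.comp (Continuous.continuousOn (by fun_prop)) ?_
  intro τ hτ
  simpa [closedStrip] using hτ

/-- If the imaginary part is Hölder continuous at a boundary point `s₀`, then the oscillation of
the function on the vertical segment from `s₀` to the middle of the strip is controlled by the
Hölder constant. -/
lemma norm_vertical_sub_le {f : ℂ → ℂ} {D s₀ : ℝ} (hc : ContinuousOn f closedStrip)
    (hd : DifferentiableOn ℂ f openStrip) (hD : 0 < D)
    (him : ∀ z ∈ closedStrip, ‖z - s₀‖ ≤ 1 →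
      |(f z).im - (f s₀).im| ≤ D * ‖z - s₀‖ ^ (1 / 4 : ℝ)) {t : ℝ}
    (ht0 : 0 ≤ t) (ht1 : t ≤ 1 / 2) :
    ‖f (s₀ + Complex.I / 2) - f (s₀ + t * Complex.I)‖ ≤ 128 * D := by
  have hderiv : ∀ τ : ℝ, 0 < τ → τ ≤ 1 / 2 →
      ‖deriv f (s₀ + τ * Complex.I)‖ ≤ 128 * D * (1 / 4 * τ ^ ((1 / 4 : ℝ) - 1)) := by
    intro τ hτ0 hτ1
    have hball : ∀ z ∈ Metric.ball (s₀ + τ * Complex.I) (τ / 2),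
        z ∈ openStrip ∧ ‖z - s₀‖ ≤ 2 * τ ∧ ‖z - s₀‖ ≤ 1 := by
      intro z hz
      rw [mem_ball_iff_norm] at hz
      have h1 := abs_lt.1 ((Complex.abs_im_le_norm _).trans_lt hz)
      simp only [Complex.sub_im, Complex.add_im, Complex.ofReal_im, Complex.mul_im,
        Complex.ofReal_re, Complex.I_im, Complex.I_re, mul_one, mul_zero, zero_add,
        add_zero] at h1
      have h2 : ‖z - s₀‖ ≤ ‖z - (s₀ + τ * Complex.I)‖ + ‖(τ * Complex.I : ℂ)‖ := by
        refine le_trans (le_of_eq ?_) (norm_add_le _ _)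
        congr 1
        ring
      have h3 : ‖(τ * Complex.I : ℂ)‖ = τ := by simp [abs_of_pos hτ0]
      rw [h3] at h2
      exact ⟨⟨by linarith, by linarith⟩, by linarith, by linarith⟩
    have h4 := norm_deriv_le_of_abs_im_sub_le (f := f) (c := s₀ + τ * Complex.I) (R := τ / 2)
      (N := D * (2 * τ ^ (1 / 4 : ℝ))) (h := (f s₀).im) (by positivity) (by positivity)
      (hd.mono fun z hz => (hball z hz).1) (fun z hz => ?_)
    · refine h4.trans (le_of_eq ?_)
      rw [Real.rpow_sub_one hτ0.ne']
      field_simp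
      norm_num
    · obtain ⟨h5, h6, h7⟩ := hball z hz
      refine (him z (openStrip_subset_closedStrip h5) h7).trans ?_
      gcongr
      calc ‖z - s₀‖ ^ (1 / 4 : ℝ) ≤ (2 * τ) ^ (1 / 4 : ℝ) := by gcongr
        _ = 2 ^ (1 / 4 : ℝ) * τ ^ (1 / 4 : ℝ) := Real.mul_rpow (by norm_num) hτ0.le
        _ ≤ 2 * τ ^ (1 / 4 : ℝ) := by
          gcongr
          calc (2 : ℝ) ^ (1 / 4 : ℝ) ≤ 2 ^ (1 : ℝ) :=
                Real.rpow_le_rpow_of_exponent_le (by norm_num) (by norm_num)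
            _ = 2 := Real.rpow_one 2
  have hcv := continuousOn_vertical hc s₀
  have hpos : ∀ ε ∈ Set.Ioo (0 : ℝ) (1 / 2),
      ‖f (s₀ + Complex.I / 2) - f (s₀ + ε * Complex.I)‖ ≤ 128 * D := by
    intro ε hε
    have hmid : (s₀ + Complex.I / 2 : ℂ) = s₀ + ((1 / 2 : ℝ) : ℂ) * Complex.I := by
      push_cast; ring
    have hmvt := image_norm_le_of_norm_deriv_right_le_deriv_boundary'
      (f := fun τ : ℝ => f (s₀ + τ * Complex.I) - f (s₀ + ε * Complex.I))
      (f' := fun τ : ℝ => deriv f (s₀ + τ * Complex.I) * Complex.I) (a := ε) (b := 1 / 2)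
      (B := fun τ : ℝ => 128 * D * τ ^ (1 / 4 : ℝ))
      (B' := fun τ : ℝ => 128 * D * (1 / 4 * τ ^ ((1 / 4 : ℝ) - 1)))
      ((hcv.mono (Set.Icc_subset_Icc hε.1.le (by norm_num))).sub continuousOn_const)
      (fun x hx => ((hasDerivAt_vertical hd (hε.1.trans_le hx.1)
        (hx.2.trans (by norm_num))).sub_const _).hasDerivWithinAt)
      (by
        have := hε.1
        simp only [sub_self, norm_zero]
        positivity)
      (Continuous.continuousOn
        (continuous_const.mul (Real.continuous_rpow_const (by norm_num))))
      (fun x hx => ((Real.hasDerivAt_rpow_const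
        (Or.inl (hε.1.trans_le hx.1).ne')).const_mul _).hasDerivWithinAt)
      (fun x hx => by
        rw [norm_mul, Complex.norm_I, mul_one]
        exact hderiv x (hε.1.trans_le hx.1) hx.2.le)
      (Set.right_mem_Icc.2 hε.2.le)
    rw [← hmid] at hmvt
    refine hmvt.trans (mul_le_of_le_one_right (by positivity) ?_)
    exact Real.rpow_le_one (by norm_num) (by norm_num) (by norm_num)
  have hcl : t ∈ closure (Set.Ioo (0 : ℝ) (1 / 2)) := by
    rw [closure_Ioo (by norm_num)]
    exact ⟨ht0, ht1⟩
  have hsub : closure (Set.Ioo (0 : ℝ) (1 / 2)) ⊆ Set.Icc 0 1 := by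
    rw [closure_Ioo (by norm_num)]
    exact Set.Icc_subset_Icc le_rfl (by norm_num)
  exact le_on_closure (f := fun τ : ℝ => ‖f (s₀ + Complex.I / 2) - f (s₀ + τ * Complex.I)‖)
    (g := fun _ => 128 * D) hpos
    (continuousOn_const.sub (hcv.mono hsub)).norm continuousOn_const hcl

/-- Interpolation between an exponential bound on the imaginary part and Lipschitz continuity on
the real axis bounds the oscillation of the function on the lower vertical segments. -/
lemma exists_norm_vertical_sub_le {f : ℂ → ℂ} {K L A c : ℝ} (hc : ContinuousOn f closedStrip)
    (hd : DifferentiableOn ℂ f openStrip) (hK : ∀ z ∈ closedStrip, |(f z).im| ≤ K)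
    (hL0 : 0 < L) (hL : ∀ x y : ℝ, |(f x).im - (f y).im| ≤ L * |x - y|) (hA : 0 < A)
    (hc1 : |c| ≤ 1) (hexp : ∀ z ∈ closedStrip, |(f z).im| ≤ A * Real.exp (c * z.re)) :
    ∃ P : ℝ, 0 < P ∧ ∀ s t : ℝ, 0 ≤ t → t ≤ 1 / 2 →
      ‖f (s + Complex.I / 2) - f (s + t * Complex.I)‖ ≤ P * Real.exp (c * s / 2) := by
  have hK0 : 0 ≤ K := (abs_nonneg _).trans (hK 0 (by simp [closedStrip]))
  refine ⟨128 * √(2 * (L + 2 * K) * (A * (Real.exp 1 + 1))), by positivity, ?_⟩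
  intro s t ht0 ht1
  have key := norm_vertical_sub_le (s₀ := s)
    (D := √(2 * (L + 2 * K) * (A * (Real.exp 1 + 1))) * Real.exp (c * s / 2))
    hc hd (by positivity) (fun z hz hzs => ?_) ht0 ht1
  · rwa [← mul_assoc] at key
  · have h1 := abs_im_sub_le_sqrt hc hd hK hL0.le hL s hz
    have h2 : |(f z).im - (f s).im| ≤ A * (Real.exp 1 + 1) * Real.exp (c * s) := by
      have h3 := hexp z hz
      have h4 := hexp s (by simp [closedStrip])
      have h5 : Real.exp (c * z.re) ≤ Real.exp 1 * Real.exp (c * s) := by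
        rw [← Real.exp_add, Real.exp_le_exp]
        have h6 : |z.re - s| ≤ 1 := by
          simpa using (Complex.abs_re_le_norm (z - s)).trans hzs
        have h7 : |c * (z.re - s)| ≤ 1 := by
          rw [abs_mul]
          exact mul_le_one₀ hc1 (abs_nonneg _) h6
        linarith [le_abs_self (c * (z.re - s))]
      rw [Complex.ofReal_re] at h4
      have h8 := abs_sub (f z).im (f s).im
      have h9 := mul_le_mul_of_nonneg_left h5 hA.le
      linarith
    have h10 : ‖z - s‖ ^ (1 / 4 : ℝ) = √(√‖z - s‖) := by
      rw [Real.sqrt_eq_rpow, Real.sqrt_eq_rpow, ← Real.rpow_mul (norm_nonneg _)]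
      norm_num
    rw [h10, Real.exp_half, ← Real.sqrt_mul (by positivity), ← Real.sqrt_mul (by positivity)]
    refine Real.le_sqrt_of_sq_le ?_
    calc |(f z).im - (f s).im| ^ 2 = |(f z).im - (f s).im| * |(f z).im - (f s).im| := sq _
      _ ≤ 2 * (L + 2 * K) * √‖z - s‖ * (A * (Real.exp 1 + 1) * Real.exp (c * s)) :=
        mul_le_mul h1 h2 (abs_nonneg _) (by positivity)
      _ = _ := by ring

/-- Exponential decay of the imaginary part forces exponential convergence along the middle line
of the strip. -/
lemma exists_limit_horizontal {f : ℂ → ℂ} {A lam : ℝ}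
    (hd : DifferentiableOn ℂ f openStrip) (hA : 0 < A) (hlam : 0 < lam)
    (hexp : ∀ z ∈ closedStrip, |(f z).im| ≤ A * Real.exp (-lam * z.re)) :
    ∃ (C : ℂ) (P : ℝ), 0 < P ∧
      ∀ s : ℝ, ‖f (s + Complex.I / 2) - C‖ ≤ P * Real.exp (-lam * s) := by
  set Q : ℝ := 16 * (A * Real.exp lam) with hQ
  have hQ0 : 0 < Q := by positivity
  have hderiv : ∀ s : ℝ, ‖deriv f (s + Complex.I / 2)‖ ≤ Q * Real.exp (-lam * s) := by
    intro s
    have hball : ∀ z ∈ Metric.ball (s + Complex.I / 2) (1 / 2),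
        z ∈ openStrip ∧ s - 1 ≤ z.re := by
      intro z hz
      rw [mem_ball_iff_norm] at hz
      have h1 := abs_lt.1 ((Complex.abs_im_le_norm _).trans_lt hz)
      have h2 := abs_lt.1 ((Complex.abs_re_le_norm _).trans_lt hz)
      simp at h1 h2
      exact ⟨⟨by linarith, by linarith⟩, by linarith⟩
    have h3 := norm_deriv_le_of_abs_im_sub_le (f := f) (c := s + Complex.I / 2) (R := 1 / 2)
      (N := A * Real.exp lam * Real.exp (-lam * s)) (h := 0) (by norm_num) (by positivity)
      (hd.mono fun z hz => (hball z hz).1) (fun z hz => ?_)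
    · refine h3.trans (le_of_eq ?_)
      rw [hQ]
      ring
    · obtain ⟨h4, h5⟩ := hball z hz
      rw [sub_zero]
      refine (hexp z (openStrip_subset_closedStrip h4)).trans ?_
      rw [mul_assoc, ← Real.exp_add]
      gcongr
      nlinarith
  have hmvt : ∀ x y : ℝ, x ≤ y →
      ‖f (y + Complex.I / 2) - f (x + Complex.I / 2)‖ ≤ Q / lam * Real.exp (-lam * x) := by
    intro x y hxy
    have h6 := image_norm_le_of_norm_deriv_right_le_deriv_boundary
      (f := fun σ : ℝ => f (σ + Complex.I / 2) - f (x + Complex.I / 2))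
      (f' := fun σ : ℝ => deriv f (σ + Complex.I / 2)) (a := x) (b := y)
      (B := fun σ : ℝ => Q / lam * (Real.exp (-lam * x) - Real.exp (-lam * σ)))
      (B' := fun σ : ℝ => Q * Real.exp (-lam * σ))
      (fun σ _ => ((hasDerivAt_horizontal hd σ).sub_const _).continuousAt.continuousWithinAt)
      (fun σ _ => ((hasDerivAt_horizontal hd σ).sub_const _).hasDerivWithinAt)
      (by simp)
      (fun σ => by
        have h7 : HasDerivAt (fun σ : ℝ => Real.exp (-lam * σ)) (Real.exp (-lam * σ) * -lam) σ := by
          simpa using ((hasDerivAt_id σ).const_mul (-lam)).exp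
        have h8 : Q * Real.exp (-lam * σ) = Q / lam * -(Real.exp (-lam * σ) * -lam) := by
          field_simp
        rw [h8]
        exact (h7.const_sub (Real.exp (-lam * x))).const_mul (Q / lam))
      (fun σ _ => hderiv σ)
      (Set.right_mem_Icc.2 hxy)
    refine h6.trans ?_
    gcongr
    linarith [Real.exp_pos (-lam * y)]
  have htend : Filter.Tendsto (fun x : ℝ => Q / lam * Real.exp (-lam * x)) Filter.atTop
      (nhds 0) := by
    have h8 : Filter.Tendsto (fun x : ℝ => -lam * x) Filter.atTop Filter.atBot :=
      Filter.tendsto_id.const_mul_atTop_of_neg (by linarith)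
    simpa using (Real.tendsto_exp_atBot.comp h8).const_mul (Q / lam)
  have hcauchy : CauchySeq (fun x : ℝ => f (x + Complex.I / 2)) :=
    cauchySeq_of_le_tendsto_0' _ (fun x y hxy => by
      rw [dist_comm, dist_eq_norm]
      exact hmvt x y hxy) htend
  obtain ⟨C, hC⟩ := cauchySeq_tendsto_of_complete hcauchy
  refine ⟨C, Q / lam, by positivity, fun s => ?_⟩
  rw [norm_sub_rev]
  refine le_of_tendsto (hC.sub_const _).norm ?_
  filter_upwards [Filter.eventually_ge_atTop s] with y hy using hmvt s y hy

/-- A function on the strip whose imaginary part is bounded, Lipschitz on the boundary and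
exponentially small converges exponentially to a constant. -/
lemma exists_limit_of_abs_im_le_exp {f : ℂ → ℂ} {K L A lam : ℝ}
    (hc : ContinuousOn f closedStrip) (hd : DifferentiableOn ℂ f openStrip)
    (hK : ∀ z ∈ closedStrip, |(f z).im| ≤ K) (hL0 : 0 < L)
    (hL : ∀ x y : ℝ, |(f x).im - (f y).im| ≤ L * |x - y|)
    (hL' : ∀ x y : ℝ, |(f (x + Complex.I)).im - (f (y + Complex.I)).im| ≤ L * |x - y|)
    (hA : 0 < A) (hlam0 : 0 < lam) (hlam1 : lam < 1)
    (hexp : ∀ z ∈ closedStrip, |(f z).im| ≤ A * Real.exp (-lam * z.re)) :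
    ∃ (C : ℂ) (P Q : ℝ), 0 < P ∧ 0 < Q ∧ ∀ s t : ℝ, 0 ≤ t → t ≤ 1 →
      ‖f (s + t * Complex.I) - C‖ ≤ P * Real.exp (-lam * s) + Q * Real.exp (-lam * s / 2) := by
  obtain ⟨C, P, hP, hPs⟩ := exists_limit_horizontal hd hA hlam0 hexp
  have habs : |lam| ≤ 1 := by rw [abs_of_pos hlam0]; exact hlam1.le
  obtain ⟨Q₁, hQ₁, hlow⟩ := exists_norm_vertical_sub_le hc hd hK hL0 hL hA
    (by rwa [abs_neg]) hexp
  have hrefl : Set.MapsTo (fun z : ℂ => Complex.I - z) closedStrip closedStrip := by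
    intro z hz
    exact ⟨by simpa using hz.2, by simpa using hz.1⟩
  have hrefl' : Set.MapsTo (fun z : ℂ => Complex.I - z) openStrip openStrip := by
    intro z hz
    exact ⟨by simpa using hz.2, by simpa using hz.1⟩
  obtain ⟨Q₂, hQ₂, hhigh⟩ := exists_norm_vertical_sub_le (f := fun z => f (Complex.I - z))
    (c := lam) (K := K) (L := L) (A := A)
    (hc.comp (Continuous.continuousOn (by fun_prop)) hrefl)
    (hd.comp (by fun_prop) hrefl')
    (fun z hz => hK _ (hrefl hz)) hL0
    (fun x y => by
      have := hL' (-x) (-y)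
      rw [← abs_neg (-x - -y)] at this
      convert this using 3
      · push_cast; ring_nf
      · push_cast; ring_nf
      · ring) hA habs
    (fun z hz => by simpa using hexp _ (hrefl hz))
  refine ⟨C, P, Q₁ + Q₂, hP, by positivity, fun s t ht0 ht1 => ?_⟩
  have htri : ‖f (s + t * Complex.I) - C‖ ≤ ‖f (s + Complex.I / 2) - C‖ +
      ‖f (s + Complex.I / 2) - f (s + t * Complex.I)‖ := by
    rw [norm_sub_rev (f (s + Complex.I / 2)) (f (s + t * Complex.I)),
      add_comm ‖f (s + Complex.I / 2) - C‖]
    exact norm_sub_le_norm_sub_add_norm_sub _ _ _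
  refine htri.trans (add_le_add (hPs s) ?_)
  rcases le_total t (1 / 2) with ht | ht
  · refine (hlow s t ht0 ht).trans ?_
    gcongr
    linarith
  · have h1 := hhigh (-s) (1 - t) (by linarith) (by linarith)
    have e1 : Complex.I - (((-s : ℝ) : ℂ) + Complex.I / 2) = s + Complex.I / 2 := by
      push_cast; ring
    have e2 : Complex.I - (((-s : ℝ) : ℂ) + ((1 - t : ℝ) : ℂ) * Complex.I) =
        s + t * Complex.I := by
      push_cast; ring
    simp only [e1, e2] at h1
    refine h1.trans ?_
    rw [show lam * -s / 2 = -lam * s / 2 by ring]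
    gcongr
    linarith

lemma abs_sub_le_of_abs_deriv_le {h : ℝ → ℝ} {L : ℝ} (hh : ContDiff ℝ 1 h)
    (hL : ∀ s, |deriv h s| ≤ L) (x y : ℝ) : |h x - h y| ≤ L * |x - y| :=
  Convex.norm_image_sub_le_of_norm_deriv_le (s := Set.univ)
    (fun s _ => (hh.differentiable one_ne_zero) s) (fun s _ => hL s) convex_univ
    (Set.mem_univ y) (Set.mem_univ x)

lemma abs_le_mul_exp_of_eventual_bound {u S₀ M K lam s : ℝ} (hlam : 0 < lam) (hM : 0 < M)
    (hK0 : 0 ≤ K) (hK : |u| ≤ K) (hu : S₀ ≤ s → |u| ≤ M * Real.exp (-lam * s)) :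
    |u| ≤ (M + K * Real.exp (lam * S₀)) * Real.exp (-lam * s) := by
  rcases le_total S₀ s with h | h
  · refine (hu h).trans ?_
    gcongr
    linarith [mul_nonneg hK0 (Real.exp_pos (lam * S₀)).le]
  · have h1 : 1 ≤ Real.exp (lam * S₀) * Real.exp (-lam * s) := by
      rw [← Real.exp_add]
      exact Real.one_le_exp (by nlinarith)
    have h2 := mul_le_mul_of_nonneg_left h1 hK0
    have h3 := mul_pos hM (Real.exp_pos (-lam * s))
    linarith

/-- The analytic core of the lifting lemma: a holomorphic function `a` on the strip, continuous
up to the boundary and with bounded imaginary part, whose boundary imaginary values are `C¹`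
with bounded derivative and converge exponentially to constants `C₋, C₊` (with exponentially
small derivatives), is equal to `C + (C₊ − C₋)(s + it)` up to an exponentially small error. -/
theorem holomorphic_strip_asymptotics
    (lam Cm Cp S₀ M : ℝ) (hlam0 : 0 < lam) (hlam1 : lam < 1) (hM : 0 < M)
    (a : ℂ → ℂ)
    (hcont : ContinuousOn a closedStrip)
    (hhol : DifferentiableOn ℂ a openStrip)
    (hbdd : ∃ K : ℝ, ∀ z ∈ closedStrip, |(a z).im| ≤ K)
    (hmC1 : ContDiff ℝ 1 (fun s : ℝ => (a s).im))
    (hpC1 : ContDiff ℝ 1 (fun s : ℝ => (a (s + Complex.I)).im))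
    (hmb' : ∃ K : ℝ, ∀ s : ℝ, |deriv (fun x : ℝ => (a x).im) s| ≤ K)
    (hpb' : ∃ K : ℝ, ∀ s : ℝ, |deriv (fun x : ℝ => (a (x + Complex.I)).im) s| ≤ K)
    (hdm : ∀ s : ℝ, S₀ ≤ s → |(a s).im - Cm| ≤ M * Real.exp (-lam * s))
    (hdp : ∀ s : ℝ, S₀ ≤ s → |(a (s + Complex.I)).im - Cp| ≤ M * Real.exp (-lam * s))
    (hdm' : ∀ s : ℝ, S₀ ≤ s →
      |deriv (fun x : ℝ => (a x).im) s| ≤ M * Real.exp (-lam * s))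
    (hdp' : ∀ s : ℝ, S₀ ≤ s →
      |deriv (fun x : ℝ => (a (x + Complex.I)).im) s| ≤ M * Real.exp (-lam * s)) :
    ∃ (C : ℂ) (lam' M' : ℝ), 0 < lam' ∧ 0 < M' ∧
      ∀ s t : ℝ, S₀ + 1 ≤ s → 0 ≤ t → t ≤ 1 →
        ‖a (s + t * Complex.I) - C - (Cp - Cm : ℂ) * (s + t * Complex.I)‖
          ≤ M' * Real.exp (-lam' * s) := by
  obtain ⟨K, hK⟩ := hbdd
  obtain ⟨L₁, hL₁⟩ := hmb'
  obtain ⟨L₂, hL₂⟩ := hpb'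
  set b : ℂ → ℂ := fun z => a z - ((Cp - Cm : ℝ) : ℂ) * z - Cm * Complex.I with hb
  have hbim : ∀ z, (b z).im = (a z).im - (Cp - Cm) * z.im - Cm := by
    intro z
    simp only [hb, Complex.sub_im, Complex.im_ofReal_mul, Complex.I_im, mul_one]
  have hbc : ContinuousOn b closedStrip :=
    (hcont.sub (Continuous.continuousOn (by fun_prop))).sub continuousOn_const
  have hbd : DifferentiableOn ℂ b openStrip :=
    (hhol.sub (Differentiable.differentiableOn (by fun_prop))).sub_const _
  set K' : ℝ := K + |Cp - Cm| + |Cm| with hK'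
  have hbK : ∀ z ∈ closedStrip, |(b z).im| ≤ K' := by
    intro z hz
    rw [hbim]
    have h1 : |(Cp - Cm) * z.im| ≤ |Cp - Cm| := by
      rw [abs_mul, abs_of_nonneg hz.1]
      exact mul_le_of_le_one_right (abs_nonneg _) hz.2
    linarith [abs_sub ((a z).im - (Cp - Cm) * z.im) Cm, abs_sub (a z).im ((Cp - Cm) * z.im),
      hK z hz]
  have hK'0 : 0 ≤ K' := (abs_nonneg _).trans (hbK 0 (by simp [closedStrip]))
  set L : ℝ := max L₁ L₂ + 1 with hLdef
  have hL₁0 : 0 ≤ L₁ := (abs_nonneg _).trans (hL₁ 0)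
  have hL0 : 0 < L := by
    have := le_max_left L₁ L₂
    linarith
  have hbL : ∀ x y : ℝ, |(b x).im - (b y).im| ≤ L * |x - y| := by
    intro x y
    have h2 := abs_sub_le_of_abs_deriv_le hmC1
      (fun s => (hL₁ s).trans (by linarith [le_max_left L₁ L₂] : L₁ ≤ L)) x y
    simpa [hbim] using h2
  have hbL' : ∀ x y : ℝ,
      |(b (x + Complex.I)).im - (b (y + Complex.I)).im| ≤ L * |x - y| := by
    intro x y
    have h2 := abs_sub_le_of_abs_deriv_le hpC1
      (fun s => (hL₂ s).trans (by linarith [le_max_right L₁ L₂] : L₂ ≤ L)) x y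
    simpa [hbim] using h2
  set A : ℝ := M + K' * Real.exp (lam * S₀) with hAdef
  have hA : 0 < A := by positivity
  have hexp : ∀ z ∈ closedStrip, |(b z).im| ≤ 2 * A * Real.exp (-lam * z.re) := by
    refine fun z hz => abs_im_le_exp hlam0 hlam1 hA.le hbc hbd hbK ?_ ?_ hz
    · intro w hw
      refine abs_le_mul_exp_of_eventual_bound hlam0 hM hK'0
        (hbK w (by simp [closedStrip, hw])) fun hs => ?_
      have hw' : w = (w.re : ℂ) := by apply Complex.ext <;> simp [hw]
      have h3 := hdm w.re hs
      rw [← hw'] at h3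
      simpa [hbim, hw] using h3
    · intro w hw
      refine abs_le_mul_exp_of_eventual_bound hlam0 hM hK'0
        (hbK w (by simp [closedStrip, hw])) fun hs => ?_
      have hw' : w = (w.re : ℂ) + Complex.I := by apply Complex.ext <;> simp [hw]
      have h3 := hdp w.re hs
      rw [← hw'] at h3
      rw [hbim, hw]
      convert h3 using 2
      ring
  obtain ⟨C, P, Q, hP, hQ, hPQ⟩ := exists_limit_of_abs_im_le_exp hbc hbd hbK hL0 hbL hbL'
    (by positivity : 0 < 2 * A) hlam0 hlam1 hexp
  refine ⟨C + Cm * Complex.I, lam / 2, P * Real.exp (-lam * (S₀ + 1) / 2) + Q, by positivity,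
    by positivity, fun s t hs ht0 ht1 => ?_⟩
  have h4 := hPQ s t ht0 ht1
  have h5 : b (s + t * Complex.I) - C = a (s + t * Complex.I) - (C + Cm * Complex.I) -
      (Cp - Cm : ℂ) * (s + t * Complex.I) := by
    simp only [hb]
    push_cast
    ring
  rw [h5] at h4
  refine h4.trans ?_
  have h6 : Real.exp (-lam * s) ≤ Real.exp (-lam * (S₀ + 1) / 2) * Real.exp (-(lam / 2) * s) := by
    rw [← Real.exp_add, Real.exp_le_exp]
    nlinarith
  rw [show -lam * s / 2 = -(lam / 2) * s by ring]
  linarith [mul_le_mul_of_nonneg_left h6 hP.le]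
end
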